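/- Let P_{m,k} be a generalized Petersen graph (m ≥ 3, k ≥ 1) of order 2m and T a tree of order n. Let d_t = diam(T), L(T) the total level of T, and ε = ε(T). Then rn(P_{m,k} □ T) ≥ (2mn − 1)(d_t + ε) − 4m·L(T). -/

import Mathlib

/-!
Common definitions: radio labelings, weight centers, levels, branches,
generalized Petersen graphs, stars.
-/

open Finset

namespace RadioPaper

variable {V : Type*}

/-- The diameter of a finite graph: the maximum distance between two vertices. -/
noncomputable def graphDiam [Fintype V] (G : SimpleGraph V) : ℕ :=
  Finset.univ.sup fun p : V × V => G.dist p.1 p.2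

/-- A radio labeling of `G`: `|f u - f v| ≥ diam G + 1 - d(u,v)` for distinct `u, v`. -/
def IsRadioLabeling [Fintype V] (G : SimpleGraph V) (f : V → ℕ) : Prop :=
  ∀ u v : V, u ≠ v → (graphDiam G : ℤ) + 1 - G.dist u v ≤ |(f u : ℤ) - (f v : ℤ)|

/-- The span of a labeling: the maximum of `|f u - f v|` over all pairs of vertices. -/
noncomputable def radioSpan [Fintype V] (f : V → ℕ) : ℕ :=
  Finset.univ.sup fun p : V × V => f p.1 - f p.2

/-- The radio number of `G`: the minimum span over all radio labelings. -/
noncomputable def radioNumber [Fintype V] (G : SimpleGraph V) : ℕ :=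
  sInf {s : ℕ | ∃ f : V → ℕ, IsRadioLabeling G f ∧ radioSpan f = s}

/-- The weight of a graph at a vertex `u`: the sum of distances from `u` to all vertices. -/
noncomputable def weight [Fintype V] (T : SimpleGraph V) (u : V) : ℕ :=
  ∑ v : V, T.dist u v

/-- The set of weight centers: vertices minimizing the weight. -/
def weightCenters [Fintype V] (T : SimpleGraph V) : Set V :=
  {c | ∀ u : V, weight T c ≤ weight T u}

/-- The level of a vertex: its distance to a nearest weight center. -/
noncomputable def level [Fintype V] (T : SimpleGraph V) (x : V) : ℕ :=
  sInf {d : ℕ | ∃ w ∈ weightCenters T, T.dist x w = d}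

/-- The total level of `T`: sum of the levels of all vertices. -/
noncomputable def totalLevel [Fintype V] (T : SimpleGraph V) : ℕ :=
  ∑ x : V, level T x

/-- `ε(T) = 1` if `T` has a unique weight center, and `0` otherwise (two centers). -/
noncomputable def eps [Fintype V] (T : SimpleGraph V) : ℕ :=
  if (weightCenters T).ncard = 1 then 1 else 0

/-- `z` is an ancestor of `x` in the tree rooted at its weight center(s):
`z` lies on the path from some weight center to `x`. -/
def IsAncestor [Fintype V] (T : SimpleGraph V) (z x : V) : Prop :=
  ∃ w ∈ weightCenters T, T.dist w z + T.dist z x = T.dist w x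

/-- `φ_T(x,y)`: the maximum level of a common ancestor of `x` and `y`. -/
noncomputable def phi [Fintype V] (T : SimpleGraph V) (x y : V) : ℕ :=
  sSup {l : ℕ | ∃ z : V, IsAncestor T z x ∧ IsAncestor T z y ∧ level T z = l}

/-- `x` and `y` are in opposite branches: `T` has two weight centers `w, w'` and
`x, y` lie in different components of `T - ww'`. -/
def OppositeBranches [Fintype V] (T : SimpleGraph V) (x y : V) : Prop :=
  ∃ w w' : V, w ≠ w' ∧ weightCenters T = {w, w'} ∧
    ¬ (T.deleteEdges {s(w, w')}).Reachable x y

open Classical in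
/-- `δ_T(x,y) = 1` if `T` has two weight centers and `x, y` are in opposite branches,
and `0` otherwise. -/
noncomputable def delta [Fintype V] (T : SimpleGraph V) (x y : V) : ℕ :=
  if (weightCenters T).ncard = 2 ∧ OppositeBranches T x y then 1 else 0

/-- `x` and `y` are in different branches: some weight center lies on the `x`–`y` path
(equivalently, the paths from the center to `x` and to `y` depart through different
neighbours, or one of `x, y` is a weight center). -/
def DifferentBranches [Fintype V] (T : SimpleGraph V) (x y : V) : Prop :=
  ∃ w ∈ weightCenters T, T.dist x w + T.dist w y = T.dist x y

/-- `x` and `y` are in the same branch: both belong to the branch of `T` induced by some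
non-central neighbour `u` of a weight center `w` together with all of `u`'s descendants. -/
def SameBranch [Fintype V] (T : SimpleGraph V) (x y : V) : Prop :=
  ∃ w ∈ weightCenters T, ∃ u : V, u ∉ weightCenters T ∧ T.Adj w u ∧
    T.dist w x = 1 + T.dist u x ∧ T.dist w y = 1 + T.dist u y

/-- The generalized Petersen graph `P_{m,k}`: outer vertices `(false, i)` (the `u_i`) and
inner vertices `(true, i)` (the `v_i`), with edges `u_i u_{i+1}`, `u_i v_i`, `v_i v_{i+k}`. -/
def genPetersen (m k : ℕ) : SimpleGraph (Bool × ZMod m) :=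
  SimpleGraph.fromRel fun a b =>
    (a.1 = false ∧ b.1 = false ∧ b.2 = a.2 + 1) ∨
    (a.1 = false ∧ b.1 = true ∧ a.2 = b.2) ∨
    (a.1 = true ∧ b.1 = true ∧ b.2 = a.2 + (k : ZMod m))

/-- The star `K_{1,n}`: vertex `0` is the centre, joined to the `n` leaves. -/
def starGraph (n : ℕ) : SimpleGraph (Fin (n + 1)) :=
  SimpleGraph.fromRel fun a _ => a = 0

section Diameter

variable [Fintype V]

theorem dist_le_graphDiam (G : SimpleGraph V) (u v : V) : G.dist u v ≤ graphDiam G :=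
  Finset.le_sup (f := fun p : V × V => G.dist p.1 p.2) (mem_univ (u, v))

theorem exists_dist_eq_graphDiam [Nonempty V] (G : SimpleGraph V) :
    ∃ u v : V, G.dist u v = graphDiam G := by
  obtain ⟨p, -, hp⟩ := Finset.exists_mem_eq_sup (univ : Finset (V × V)) univ_nonempty
    fun p => G.dist p.1 p.2
  exact ⟨p.1, p.2, hp.symm⟩

theorem sub_le_radioSpan (f : V → ℕ) (u v : V) : f u - f v ≤ radioSpan f :=
  Finset.le_sup (f := fun p : V × V => f p.1 - f p.2) (mem_univ (u, v))

theorem exists_isRadioLabeling (G : SimpleGraph V) : ∃ f : V → ℕ, IsRadioLabeling G f := by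
  refine ⟨fun v => Fintype.equivFin V v * (graphDiam G + 1), fun u v huv => ?_⟩
  have hne : ((Fintype.equivFin V u : ℕ) : ℤ) - (Fintype.equivFin V v : ℕ) ≠ 0 := by
    rw [sub_ne_zero]
    exact_mod_cast fun h => huv ((Fintype.equivFin V).injective (Fin.ext h))
  have hone := Int.one_le_abs hne
  push_cast
  rw [← sub_mul, abs_mul, abs_of_nonneg (by positivity : (0 : ℤ) ≤ graphDiam G + 1)]
  nlinarith [Int.natCast_nonneg (G.dist u v), Int.natCast_nonneg (graphDiam G)]

theorem exists_isRadioLabeling_radioSpan_eq (G : SimpleGraph V) :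
    ∃ f : V → ℕ, IsRadioLabeling G f ∧ radioSpan f = radioNumber G := by
  obtain ⟨f, hf⟩ := exists_isRadioLabeling G
  exact Nat.sInf_mem (s := {s | ∃ f : V → ℕ, IsRadioLabeling G f ∧ radioSpan f = s})
    ⟨_, f, hf, rfl⟩

end Diameter

/-- If consecutive values of `f` differ by at least `c - L u - L v`, then telescoping along the
ordering of `s` by `f` bounds the range of `f` on `s` from below. -/
theorem exists_card_sub_one_mul_sub_le (f L : V → ℕ) (c : ℤ)
    (h : ∀ u v, u ≠ v → f v ≤ f u → c - L u - L v ≤ (f u : ℤ) - f v)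
    (s : Finset V) (hs : s.Nonempty) :
    ∃ u ∈ s, ∃ v ∈ s, (∀ x ∈ s, f x ≤ f u) ∧
      ((#s : ℤ) - 1) * c - 2 * ∑ x ∈ s, (L x : ℤ) + L u + L v ≤ (f u : ℤ) - f v := by
  classical
  induction s using Finset.induction_on_max_value f with
  | empty => simp at hs
  | insert a s ha hmax ih =>
    rcases s.eq_empty_or_nonempty with rfl | hne
    · refine ⟨a, by simp, a, by simp, by simp, ?_⟩
      simp only [insert_empty_eq, card_singleton, sum_singleton]
      push_cast
      linarith
    · obtain ⟨u, hu, v, hv, -, huv⟩ := ih hne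
      refine ⟨a, mem_insert_self _ _, v, mem_insert_of_mem hv, ?_, ?_⟩
      · simpa using hmax
      · have hau := h a u (fun e => ha (e ▸ hu)) (hmax u hu)
        rw [card_insert_of_notMem ha, sum_insert ha]
        push_cast
        linarith


section Connected

theorem dist_boxProd {W : Type*} {G : SimpleGraph V} {H : SimpleGraph W} (hG : G.Connected)
    (hH : H.Connected) (x y : V × W) :
    (G.boxProd H).dist x y = G.dist x.1 y.1 + H.dist x.2 y.2 := by
  rw [SimpleGraph.dist, SimpleGraph.edist_boxProd, ENat.toNat_add]
  · rfl
  · exact SimpleGraph.edist_ne_top_iff_reachable.2 (hG _ _)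
  · exact SimpleGraph.edist_ne_top_iff_reachable.2 (hH _ _)

theorem graphDiam_add_le_graphDiam_boxProd {W : Type*} [Fintype V] [Fintype W]
    {G : SimpleGraph V} {H : SimpleGraph W} (hG : G.Connected) (hH : H.Connected) :
    graphDiam G + graphDiam H ≤ graphDiam (G.boxProd H) := by
  have := hG.nonempty
  have := hH.nonempty
  obtain ⟨a, b, hab⟩ := exists_dist_eq_graphDiam G
  obtain ⟨c, d, hcd⟩ := exists_dist_eq_graphDiam H
  have := dist_le_graphDiam (G.boxProd H) (a, c) (b, d)
  rwa [dist_boxProd hG hH, hab, hcd] at this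

theorem exists_adj_dist_eq_dist_add_one {G : SimpleGraph V} (hG : G.Connected) {a c : V}
    (h : a ≠ c) : ∃ b, G.Adj a b ∧ G.dist a c = G.dist b c + 1 := by
  obtain ⟨p, hp⟩ := hG.exists_walk_length_eq_dist a c
  cases p with
  | nil => exact absurd rfl h
  | @cons _ b _ hab q =>
    refine ⟨b, hab, le_antisymm ?_ ?_⟩
    · have := hG.dist_triangle (u := a) (v := b) (w := c)
      rw [SimpleGraph.dist_eq_one_iff_adj.2 hab] at this
      omega
    · rw [← hp, SimpleGraph.Walk.length_cons]
      exact Nat.add_le_add_right (SimpleGraph.dist_le q) 1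

theorem exists_mem_weightCenters_dist_eq_level [Fintype V] [Nonempty V] (G : SimpleGraph V)
    (x : V) : ∃ w ∈ weightCenters G, G.dist x w = level G x := by
  obtain ⟨w, hw⟩ := Finite.exists_min (weight G)
  exact Nat.sInf_mem (s := {d | ∃ w ∈ weightCenters G, G.dist x w = d}) ⟨_, w, hw, rfl⟩

theorem genPetersen_connected (m k : ℕ) [NeZero m] : (genPetersen m k).Connected := by
  have hspoke (i : ZMod m) : (genPetersen m k).Adj (false, i) (true, i) := by
    simp [genPetersen]
  have hrim (i : ZMod m) : (genPetersen m k).Reachable (false, i) (false, i + 1) := by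
    by_cases h : i = i + 1
    · rw [← h]
    · exact SimpleGraph.Adj.reachable (by simpa [genPetersen] using h)
  have hnat (i : ℕ) : (genPetersen m k).Reachable (false, 0) (false, (i : ZMod m)) := by
    induction i with
    | zero => simp
    | succ i ih => simpa using ih.trans (hrim i)
  have houter (i : ZMod m) : (genPetersen m k).Reachable (false, 0) (false, i) := by
    simpa using hnat i.val
  have hall (x : Bool × ZMod m) : (genPetersen m k).Reachable (false, 0) x := by
    obtain ⟨_ | _, i⟩ := x
    · exact houter i
    · exact (houter i).trans (hspoke i).reachable
  exact SimpleGraph.Connected.mk fun x y => (hall x).symm.trans (hall y)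

end Connected

section Tree

variable {T : SimpleGraph V}

theorem eq_of_adj_of_dist_add_one_eq (hT : T.IsTree) {a b c v : V} (hba : T.Adj b a)
    (hbc : T.Adj b c) (ha : T.dist a v + 1 = T.dist b v) (hc : T.dist c v + 1 = T.dist b v) :
    a = c := by
  obtain ⟨p, hp⟩ := hT.connected.exists_walk_length_eq_dist a v
  obtain ⟨q, hq⟩ := hT.connected.exists_walk_length_eq_dist c v
  have hp' := (SimpleGraph.Walk.cons hba p).isPath_of_length_eq_dist (by simp [hp, ha])
  have hq' := (SimpleGraph.Walk.cons hbc q).isPath_of_length_eq_dist (by simp [hq, hc])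
  have h := congrArg (fun r : T.Path b v => r.1.snd)
    ((hT.isAcyclic.subsingleton_path b v).elim ⟨_, hp'⟩ ⟨_, hq'⟩)
  simpa using h

theorem two_mul_dist_le_dist_add_dist (hT : T.IsTree) {a b c : V} (hba : T.Adj b a)
    (hbc : T.Adj b c) (hac : a ≠ c) (v : V) : 2 * T.dist b v ≤ T.dist a v + T.dist c v := by
  have ha := hT.dist_eq_dist_add_one_of_adj v hba
  have hc := hT.dist_eq_dist_add_one_of_adj v hbc
  simp only [T.dist_comm (u := v)] at ha hc
  by_contra! hlt
  exact hac (eq_of_adj_of_dist_add_one_eq (v := v) hT hba hbc (by omega) (by omega))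

variable [Fintype V]

theorem two_mul_weight_lt_weight_add_weight (hT : T.IsTree) {a b c : V} (hba : T.Adj b a)
    (hbc : T.Adj b c) (hac : a ≠ c) : 2 * weight T b < weight T a + weight T c := by
  unfold weight
  rw [mul_sum, ← sum_add_distrib]
  refine sum_lt_sum (fun v _ => two_mul_dist_le_dist_add_dist hT hba hbc hac v)
    ⟨b, mem_univ b, ?_⟩
  simp [SimpleGraph.dist_eq_one_iff_adj.2 hba.symm, SimpleGraph.dist_eq_one_iff_adj.2 hbc.symm]

theorem weight_lt_weight_of_dist_eq_dist_add_one (hT : T.IsTree) {a b c : V} (hba : T.Adj b a)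
    (hab : weight T a ≤ weight T b) (hac : T.dist a c = T.dist b c + 1) (hbc : b ≠ c) :
    weight T b < weight T c := by
  induction hd : T.dist b c generalizing a b with
  | zero => exact absurd (hT.connected.dist_eq_zero_iff.1 hd) hbc
  | succ d ih =>
    obtain ⟨b', hb', hdist⟩ := exists_adj_dist_eq_dist_add_one hT.connected hbc
    have hne : a ≠ b' := by
      rintro rfl
      omega
    have hconv := two_mul_weight_lt_weight_add_weight hT hba hb' hne
    have hlt : weight T b < weight T b' := by omega
    by_cases hbc' : b' = c
    · rwa [hbc'] at hlt
    · exact hlt.trans (ih hb'.symm hlt.le hdist hbc' (by omega))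

theorem dist_le_one_of_mem_weightCenters (hT : T.IsTree) {w w' : V} (hw : w ∈ weightCenters T)
    (hw' : w' ∈ weightCenters T) : T.dist w w' ≤ 1 := by
  by_cases hne : w = w'
  · simp [hne]
  obtain ⟨b, hb, hdist⟩ := exists_adj_dist_eq_dist_add_one hT.connected hne
  by_cases hbw : b = w'
  · simp [hdist, hbw]
  · exact absurd (weight_lt_weight_of_dist_eq_dist_add_one hT hb.symm (hw b) hdist hbw)
      (not_lt.2 (hw' b))

theorem dist_add_eps_le_one_of_mem_weightCenters (hT : T.IsTree) {w w' : V}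
    (hw : w ∈ weightCenters T) (hw' : w' ∈ weightCenters T) : T.dist w w' + eps T ≤ 1 := by
  unfold eps
  split_ifs with h
  · obtain ⟨c, hc⟩ := Set.ncard_eq_one.1 h
    rw [hc, Set.mem_singleton_iff] at hw hw'
    simp [hw, hw']
  · exact dist_le_one_of_mem_weightCenters hT hw hw'

theorem dist_add_eps_le_level_add_level_add_one (hT : T.IsTree) (x y : V) :
    T.dist x y + eps T ≤ level T x + level T y + 1 := by
  have := hT.connected.nonempty
  obtain ⟨w, hw, hx⟩ := exists_mem_weightCenters_dist_eq_level T x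
  obtain ⟨w', hw', hy⟩ := exists_mem_weightCenters_dist_eq_level T y
  have h₁ := hT.connected.dist_triangle (u := x) (v := w) (w := y)
  have h₂ := hT.connected.dist_triangle (u := w) (v := w') (w := y)
  have h₃ := dist_add_eps_le_one_of_mem_weightCenters hT hw hw'
  rw [T.dist_comm] at hy
  omega

/-- Lower bound for the radio number of the product of a connected graph with a tree. -/
theorem radioNumber_boxProd_tree_lower_bound {U : Type*} [Fintype U] {G : SimpleGraph U}
    (hG : G.Connected) (hT : T.IsTree) :
    ((Fintype.card U * Fintype.card V : ℤ) - 1) * ((graphDiam T : ℤ) + eps T) -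
      2 * Fintype.card U * totalLevel T ≤ (radioNumber (G.boxProd T) : ℤ) := by
  have := hG.nonempty
  have := hT.connected.nonempty
  obtain ⟨f, hf, hspan⟩ := exists_isRadioLabeling_radioSpan_eq (G.boxProd T)
  have hdiam := graphDiam_add_le_graphDiam_boxProd hG hT.connected
  obtain ⟨x, -, y, -, -, hxy⟩ := exists_card_sub_one_mul_sub_le f (fun p => level T p.2)
    ((graphDiam T : ℤ) + eps T) (fun u v huv hle => by
      have h := hf u v huv
      rw [dist_boxProd hG hT.connected,
        abs_of_nonneg (sub_nonneg.2 (by exact_mod_cast hle))] at h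
      have hdG := dist_le_graphDiam G u.1 v.1
      have hdT := dist_add_eps_le_level_add_level_add_one hT u.2 v.2
      push_cast at h
      omega) univ univ_nonempty
  have hsum : ∑ p : U × V, (level T p.2 : ℤ) = Fintype.card U * totalLevel T := by
    simp [Fintype.sum_prod_type, totalLevel]
  rw [hsum, card_univ, Fintype.card_prod] at hxy
  have hle := sub_le_radioSpan f x y
  push_cast at hxy
  have : (f x : ℤ) - f y ≤ radioNumber (G.boxProd T) := by omega
  linarith

end Tree

/-- Lower bound for the radio number of the Cartesian product of a generalized Petersen
graph and a tree: `rn(P_{m,k} □ T) ≥ (2mn - 1)(d_t + ε) - 4m·L(T)`. -/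
theorem radioNumber_genPetersen_boxProd_tree_lower_bound
    {Vt : Type*} [Fintype Vt] (m k n : ℕ) [NeZero m] (hm : 3 ≤ m) (hk : 1 ≤ k)
    (T : SimpleGraph Vt) (hT : T.IsTree) (hn : Fintype.card Vt = n) :
    ((2 * m * n : ℤ) - 1) * ((graphDiam T : ℤ) + eps T) - 4 * m * totalLevel T ≤
      (radioNumber ((genPetersen m k).boxProd T) : ℤ) := by
  have h := radioNumber_boxProd_tree_lower_bound (genPetersen_connected m k) hT
  rw [hn, Fintype.card_prod, Fintype.card_bool, ZMod.card] at h
  push_cast at h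
  linarith

end RadioPaper
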